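/- Assume X is a compact Hausdorff space, A₁, A₂ are closed subalgebras of C(X) containing the constants that satisfy the C-property, and A₁ + A₂ is closed in C(X). Then for every h ∈ C(X), the Diliberto–Straus iteration h₁ = h, h₂ₙ = h₂ₙ₋₁ − F h₂ₙ₋₁, h₂ₙ₊₁ = h₂ₙ − G h₂ₙ satisfies lim_{n→∞} ‖hₙ‖ = E(h) = inf_{w ∈ A₁+A₂} ‖h − w‖. -/

import Mathlib

open Filter Topology

/-- The equivalence relation on `X` induced by a subalgebra `A ⊆ C(X, ℝ)`:
`a ∼ b` iff `f a = f b` for all `f ∈ A`. -/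
def algSetoid {X : Type*} [TopologicalSpace X] (A : Subalgebra ℝ C(X, ℝ)) : Setoid X where
  r a b := ∀ f ∈ A, (f : C(X, ℝ)) a = f b
  iseqv := ⟨fun _ _ _ => rfl, fun h f hf => (h f hf).symm,
    fun h₁ h₂ f hf => (h₁ f hf).trans (h₂ f hf)⟩

/-- `a ↦ max_{x : s x = a} h x` on the quotient space `X₁ = X/∼`. -/
noncomputable def Fsup {X : Type*} [TopologicalSpace X] (A : Subalgebra ℝ C(X, ℝ))
    (h : X → ℝ) (a : Quotient (algSetoid A)) : ℝ :=
  sSup (h '' {x | Quotient.mk (algSetoid A) x = a})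

/-- `a ↦ min_{x : s x = a} h x` on the quotient space `X₁ = X/∼`. -/
noncomputable def Finf {X : Type*} [TopologicalSpace X] (A : Subalgebra ℝ C(X, ℝ))
    (h : X → ℝ) (a : Quotient (algSetoid A)) : ℝ :=
  sInf (h '' {x | Quotient.mk (algSetoid A) x = a})

/-- The levelling operator `F`:
`(F h)(a) = ½ (max_{s x = a} h x + min_{s x = a} h x)`, regarded via the quotient map
`s = Quotient.mk` as a function on `X`. -/
noncomputable def Fop {X : Type*} [TopologicalSpace X] (A : Subalgebra ℝ C(X, ℝ))
    (h : X → ℝ) (x : X) : ℝ :=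
  (Fsup A h (Quotient.mk (algSetoid A) x) + Finf A h (Quotient.mk (algSetoid A) x)) / 2

/-- The `C`-property of a subalgebra `A ⊆ C(X, ℝ)`: for every `h ∈ C(X)` the functions
`a ↦ max_{s x = a} h x` and `a ↦ min_{s x = a} h x` are continuous on the quotient
space `X₁`. -/
def CProperty {X : Type*} [TopologicalSpace X] (A : Subalgebra ℝ C(X, ℝ)) : Prop :=
  ∀ h : C(X, ℝ), Continuous (Fsup A ⇑h) ∧ Continuous (Finf A ⇑h)

/-- The sup norm `‖f‖ = sup_x |f x|` of a function. -/
noncomputable def supNorm {X : Type*} (f : X → ℝ) : ℝ := ⨆ x, |f x|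

section Fibers

variable {X : Type*} [TopologicalSpace X] [CompactSpace X]

/-- A closed subalgebra contains every function that factors continuously through the quotient. -/
theorem mem_of_continuous_quotient {A : Subalgebra ℝ C(X, ℝ)} (hA : IsClosed (A : Set C(X, ℝ)))
    {φ : Quotient (algSetoid A) → ℝ} (hφ : Continuous φ) :
    ∃ p ∈ A, ∀ x, p x = φ (Quotient.mk (algSetoid A) x) := by
  let π : C(X, Quotient (algSetoid A)) := ⟨Quotient.mk (algSetoid A), continuous_quotient_mk'⟩
  let T := ContinuousMap.compRightAlgHom ℝ ℝ π
  have hT : Continuous T := ContinuousMap.continuous_precomp π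
  have hclosed : IsClosed (A.comap T : Set C(Quotient (algSetoid A), ℝ)) := hA.preimage hT
  have hsep : (A.comap T).SeparatesPoints := by
    intro a b hab
    induction a using Quotient.inductionOn with | h a => ?_
    induction b using Quotient.inductionOn with | h b => ?_
    have hne : ¬ ∀ f ∈ A, (f : C(X, ℝ)) a = f b := fun H => hab (Quotient.sound H)
    push Not at hne
    obtain ⟨f, hf, hfab⟩ := hne
    let g : C(Quotient (algSetoid A), ℝ) :=
      ⟨Quotient.lift f fun _ _ h => h f hf, f.continuous.quotient_lift _⟩
    have hg : T g = f := by ext x; rfl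
    refine ⟨g, ⟨g, ?_, rfl⟩, hfab⟩
    change T g ∈ A
    rwa [hg]
  have htop := ContinuousMap.subalgebra_topologicalClosure_eq_top_of_separatesPoints _ hsep
  have hmem : (⟨φ, hφ⟩ : C(Quotient (algSetoid A), ℝ)) ∈ (A.comap T).topologicalClosure := by
    rw [htop]; trivial
  rw [← SetLike.mem_coe, Subalgebra.topologicalClosure_coe, hclosed.closure_eq] at hmem
  exact ⟨T ⟨φ, hφ⟩, hmem, fun _ => rfl⟩

theorem isCompact_fiber (A : Subalgebra ℝ C(X, ℝ)) (a : Quotient (algSetoid A)) :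
    IsCompact {x | Quotient.mk (algSetoid A) x = a} := by
  induction a using Quotient.inductionOn with | h a => ?_
  have h : {x | Quotient.mk (algSetoid A) x = Quotient.mk (algSetoid A) a}
      = ⋂ f ∈ A, {x | (f : C(X, ℝ)) x = f a} := by
    ext x
    simp only [Set.mem_ofPred_eq, Set.mem_iInter]
    exact Quotient.eq
  rw [h]
  exact (isClosed_biInter fun f _ => isClosed_eq f.continuous continuous_const).isCompact

/-- `v` arises from `u` by subtracting an element of `A`, and `v` is balanced on every fiber
of `A`: its extreme values there are opposite. -/
structure IsLevelling (A : Subalgebra ℝ C(X, ℝ)) (u v : C(X, ℝ)) : Prop where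
  sub_mem : u - v ∈ A
  balanced : ∀ s : ℝ, s = 1 ∨ s = -1 → ∀ x, ∃ y, (∀ f ∈ A, f x = f y) ∧ s * v y ≤ -(s * v x)

theorem exists_isLevelling {A : Subalgebra ℝ C(X, ℝ)} (hA : IsClosed (A : Set C(X, ℝ)))
    (hC : CProperty A) (u : C(X, ℝ)) :
    ∃ v, IsLevelling A u v ∧ ∀ x, v x = u x - Fop A u x := by
  obtain ⟨p, hpA, hp⟩ := mem_of_continuous_quotient hA
    (((hC u).1.add (hC u).2).div_const 2)
  refine ⟨u - p, ⟨by simpa using hpA, ?_⟩, fun x => by simp [hp, Fop]⟩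
  intro s hs x
  set S := {y | Quotient.mk (algSetoid A) y = Quotient.mk (algSetoid A) x} with hS
  have hSc : IsCompact S := isCompact_fiber A _
  have hx : x ∈ S := rfl
  have hrel : ∀ y ∈ S, ∀ f ∈ A, f x = f y := fun y hy => Quotient.exact (Eq.symm hy)
  have hpx : p x = (sSup (u '' S) + sInf (u '' S)) / 2 := hp x
  rcases hs with rfl | rfl
  · obtain ⟨y, hy, hmin⟩ := hSc.exists_sInf_image_eq ⟨x, hx⟩ u.continuous.continuousOn
    have hle : u x ≤ sSup (u '' S) :=
      le_csSup (hSc.image u.continuous).bddAbove ⟨x, hx, rfl⟩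
    refine ⟨y, hrel y hy, ?_⟩
    have := hrel y hy p hpA
    simp only [ContinuousMap.sub_apply]
    linarith
  · obtain ⟨y, hy, hmax⟩ := hSc.exists_sSup_image_eq ⟨x, hx⟩ u.continuous.continuousOn
    have hle : sInf (u '' S) ≤ u x :=
      csInf_le (hSc.image u.continuous).bddBelow ⟨x, hx, rfl⟩
    refine ⟨y, hrel y hy, ?_⟩
    have := hrel y hy p hpA
    simp only [ContinuousMap.sub_apply]
    linarith

theorem IsLevelling.abs_mul_sub_le {A : Subalgebra ℝ C(X, ℝ)} {u v : C(X, ℝ)}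
    (h : IsLevelling A u v) {s : ℝ} (hs : s = 1 ∨ s = -1) (x : X) :
    |s * u x - s * v x| ≤ ‖u‖ - s * v x := by
  obtain ⟨y, hy, hyx⟩ := h.balanced s hs x
  have hc := hy _ h.sub_mem
  have hux := abs_le.1 (u.norm_coe_le_norm x)
  have huy := abs_le.1 (u.norm_coe_le_norm y)
  simp only [ContinuousMap.sub_apply] at hc
  rw [abs_le]
  rcases hs with rfl | rfl <;> constructor <;> linarith [hux.1, hux.2, huy.1, huy.2]

theorem IsLevelling.norm_le {A : Subalgebra ℝ C(X, ℝ)} {u v : C(X, ℝ)}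
    (h : IsLevelling A u v) : ‖v‖ ≤ ‖u‖ := by
  rw [ContinuousMap.norm_le _ (norm_nonneg u)]
  intro x
  have h₁ := (abs_nonneg _).trans (h.abs_mul_sub_le (Or.inl rfl) x)
  have h₂ := (abs_nonneg _).trans (h.abs_mul_sub_le (Or.inr rfl) x)
  rw [Real.norm_eq_abs, abs_le]
  constructor <;> linarith

theorem neg_one_pow_mul_sign {s : ℝ} (hs : s = 1 ∨ s = -1) (i : ℕ) :
    (-1) ^ i * s = 1 ∨ (-1) ^ i * s = -1 := by
  rcases hs with rfl | rfl <;> rcases neg_one_pow_eq_or ℝ i with h | h <;> simp [h]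

theorem exists_norm_le_abs_apply [Nonempty X] (v : C(X, ℝ)) : ∃ x, ‖v‖ ≤ |v x| := by
  obtain ⟨x, -, hx⟩ := isCompact_univ.exists_isMaxOn Set.univ_nonempty
    v.continuous.abs.continuousOn
  exact ⟨x, (ContinuousMap.norm_le _ (abs_nonneg _)).2 fun y => hx (Set.mem_univ y)⟩

/-- Along a sequence of levellings whose norms are almost stationary there are bolts of any given
length on which the function is almost extremal with alternating signs. -/
theorem exists_bolt [Nonempty X] {B : ℕ → Subalgebra ℝ C(X, ℝ)} {u : ℕ → C(X, ℝ)}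
    (hu : ∀ n, IsLevelling (B n) (u n) (u (n + 1))) {M ε : ℝ} (k : ℕ) (m : ℕ)
    (hε : ∀ n, m ≤ n → ‖u n‖ ≤ M + ε) (hM : ∀ n, M ≤ ‖u n‖) :
    ∃ (x : ℕ → X) (s : ℝ), (s = 1 ∨ s = -1) ∧
      (∀ i j, i + j + 1 = k → ∀ f ∈ B (m + j), f (x i) = f (x (i + 1))) ∧
      ∀ i ≤ k, M - (2 ^ k - 1) * ε ≤ (-1) ^ i * s * u m (x i) := by
  induction k generalizing m with
  | zero =>
    obtain ⟨x, hx⟩ := exists_norm_le_abs_apply (u m)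
    have hle : M ≤ |u m x| := (hM m).trans hx
    rcases le_total 0 (u m x) with h | h
    · rw [abs_of_nonneg h] at hle
      exact ⟨fun _ => x, 1, Or.inl rfl, fun i j hij => by omega, fun i hi => by
        obtain rfl : i = 0 := by omega
        simpa using hle⟩
    · rw [abs_of_nonpos h] at hle
      exact ⟨fun _ => x, -1, Or.inr rfl, fun i j hij => by omega, fun i hi => by
        obtain rfl : i = 0 := by omega
        simpa using hle⟩
  | succ k ih =>
    obtain ⟨x, s, hs, hx, hval⟩ := ih (m + 1) fun n hn => hε n (by omega)
    obtain ⟨y, hy, hyx⟩ := (hu m).balanced _ (neg_one_pow_mul_sign hs k) (x k)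
    have hval' : ∀ i ≤ k + 1, M - (2 ^ k - 1) * ε ≤
        (-1) ^ i * s * u (m + 1) (Function.update x (k + 1) y i) := by
      intro i hi
      rcases hi.eq_or_lt with rfl | hi
      · rw [Function.update_self, pow_succ]
        linarith [hval k le_rfl]
      · rw [Function.update_of_ne hi.ne]
        exact hval i (by omega)
    refine ⟨Function.update x (k + 1) y, s, hs, ?_, fun i hi => ?_⟩
    · intro i j hij f hf
      rw [Function.update_of_ne (by omega)]
      rcases j with _ | j
      · obtain rfl : i = k := by omega
        rw [Function.update_self]
        exact hy f hf
      · rw [Function.update_of_ne (by omega)]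
        exact hx i j (by omega) f (by rwa [Nat.add_right_comm])
    · have h₁ := hval' i hi
      have h₂ := (abs_le.1 ((hu m).abs_mul_sub_le (neg_one_pow_mul_sign hs i)
        (Function.update x (k + 1) y i))).1
      have h₃ := hε m le_rfl
      rw [pow_succ]
      linarith

end Fibers

theorem alternating_sum_eq_of_even {a : ℕ → ℝ} {n : ℕ}
    (ha : ∀ i, i + 1 < n → Even i → a i = a (i + 1)) :
    ∑ i ∈ Finset.range n, (-1) ^ i * a i = if Even n then 0 else a (n - 1) := by
  induction n with
  | zero => simp
  | succ n ih =>
    rw [Finset.sum_range_succ, ih fun i hi => ha i (by omega)]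
    rcases Nat.even_or_odd n with hn | hn
    · simp [hn, Nat.even_add_one, hn.neg_one_pow]
    · have hn' : ¬ Even n := Nat.not_even_iff_odd.2 hn
      obtain ⟨r, rfl⟩ := hn
      have := ha (2 * r) (by omega) (by simp)
      simp [hn', Nat.even_add_one, this, pow_succ]

theorem abs_alternating_sum_le {a : ℕ → ℝ} {n q : ℕ} {C : ℝ} (hC : ∀ i, |a i| ≤ C)
    (ha : ∀ i, i + 1 < n → Even (i + q) → a i = a (i + 1)) :
    |∑ i ∈ Finset.range n, (-1) ^ i * a i| ≤ 2 * C := by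
  have hC0 : 0 ≤ C := (abs_nonneg _).trans (hC 0)
  rcases Nat.even_or_odd q with hq | hq
  · rw [alternating_sum_eq_of_even fun i hi he => ha i hi (he.add hq)]
    split_ifs
    · simpa using hC0
    · linarith [hC (n - 1)]
  · rcases n with _ | n
    · simpa using hC0
    · have hsum : ∑ i ∈ Finset.range (n + 1), (-1) ^ i * a i
          = a 0 - ∑ i ∈ Finset.range n, (-1) ^ i * a (i + 1) := by
        rw [Finset.sum_range_succ', sub_eq_neg_add, ← Finset.sum_neg_distrib]
        simp [pow_succ]
      rw [hsum, alternating_sum_eq_of_even (a := fun i => a (i + 1)) fun i hi he =>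
        ha (i + 1) (by omega) (by
          rw [Nat.even_iff] at *; rw [Nat.odd_iff] at hq; omega)]
      split_ifs
      · rw [sub_zero]; linarith [hC 0]
      · have h := abs_sub (a 0) (a (n - 1 + 1))
        linarith [hC 0, hC (n - 1 + 1)]

/-- If the sum of two closed subspaces of a Banach space is closed, its elements have controlled
decompositions. -/
theorem Submodule.exists_bounded_decomposition {E : Type*} [NormedAddCommGroup E]
    [NormedSpace ℝ E] [CompleteSpace E] (V W : Submodule ℝ E)
    (hV : IsClosed (V : Set E)) (hW : IsClosed (W : Set E))
    (hVW : IsClosed ((V ⊔ W : Submodule ℝ E) : Set E)) :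
    ∃ K > 0, ∀ f₀ ∈ V, ∀ g₀ ∈ W, ∃ f ∈ V, ∃ g ∈ W, f₀ + g₀ = f + g ∧
      ‖f‖ ≤ K * ‖f₀ + g₀‖ ∧ ‖g‖ ≤ K * ‖f₀ + g₀‖ := by
  have : CompleteSpace V := hV.completeSpace_coe
  have : CompleteSpace W := hW.completeSpace_coe
  have : CompleteSpace (V ⊔ W : Submodule ℝ E) := hVW.completeSpace_coe
  let T : (V × W) →L[ℝ] (V ⊔ W : Submodule ℝ E) :=
    (V.subtypeL.coprod W.subtypeL).codRestrict _ fun z => Submodule.add_mem_sup z.1.2 z.2.2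
  have hT : Function.Surjective T := by
    rintro ⟨w, hw⟩
    obtain ⟨f, hf, g, hg, rfl⟩ := Submodule.mem_sup.1 hw
    exact ⟨(⟨f, hf⟩, ⟨g, hg⟩), rfl⟩
  obtain ⟨K, hK, H⟩ := ContinuousLinearMap.exists_preimage_norm_le T hT
  refine ⟨K, hK, fun f₀ hf₀ g₀ hg₀ => ?_⟩
  obtain ⟨z, hz, hzn⟩ := H ⟨f₀ + g₀, Submodule.add_mem_sup hf₀ hg₀⟩
  exact ⟨z.1, z.1.2, z.2, z.2.2, (congrArg Subtype.val hz).symm,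
    (norm_fst_le z).trans hzn, (norm_snd_le z).trans hzn⟩

section Sum

variable {X : Type*} [TopologicalSpace X] [CompactSpace X]

/-- If the sum of two closed subalgebras is closed, its elements have controlled
decompositions. -/
theorem exists_bounded_decomposition {A₁ A₂ : Subalgebra ℝ C(X, ℝ)}
    (hA₁ : IsClosed (A₁ : Set C(X, ℝ))) (hA₂ : IsClosed (A₂ : Set C(X, ℝ)))
    (hsum : IsClosed {w : C(X, ℝ) | ∃ f ∈ A₁, ∃ g ∈ A₂, w = f + g}) :
    ∃ K > 0, ∀ f₀ ∈ A₁, ∀ g₀ ∈ A₂, ∃ f ∈ A₁, ∃ g ∈ A₂, f₀ + g₀ = f + g ∧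
      ‖f‖ ≤ K * ‖f₀ + g₀‖ ∧ ‖g‖ ≤ K * ‖f₀ + g₀‖ := by
  refine Submodule.exists_bounded_decomposition (Subalgebra.toSubmodule A₁)
    (Subalgebra.toSubmodule A₂) hA₁ hA₂ ?_
  have h : ((Subalgebra.toSubmodule A₁ ⊔ Subalgebra.toSubmodule A₂ : Submodule ℝ C(X, ℝ)) :
      Set C(X, ℝ)) = {w | ∃ f ∈ A₁, ∃ g ∈ A₂, w = f + g} := by
    ext w
    simp [Submodule.mem_sup, eq_comm]
  rw [h]
  exact hsum

/-- Every alternating sequence of levellings has norms bounded below by at most the distance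
to the sum of the two algebras. -/
theorem le_norm_sub_of_isLevelling {A₁ A₂ : Subalgebra ℝ C(X, ℝ)}
    (hA₁ : IsClosed (A₁ : Set C(X, ℝ))) (hA₂ : IsClosed (A₂ : Set C(X, ℝ)))
    (hsum : IsClosed {w : C(X, ℝ) | ∃ f ∈ A₁, ∃ g ∈ A₂, w = f + g})
    {u : ℕ → C(X, ℝ)}
    (hu : ∀ n, IsLevelling (if Even n then A₁ else A₂) (u n) (u (n + 1)))
    (hmem : ∀ n, ∃ f ∈ A₁, ∃ g ∈ A₂, u 0 - u n = f + g)
    {M : ℝ} (hM : Tendsto (fun n => ‖u n‖) atTop (𝓝 M))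
    {f₀ g₀ : C(X, ℝ)} (hf₀ : f₀ ∈ A₁) (hg₀ : g₀ ∈ A₂) : M ≤ ‖u 0 - (f₀ + g₀)‖ := by
  have hanti : Antitone fun n => ‖u n‖ := antitone_nat_of_succ_le fun n => (hu n).norm_le
  have hMle : ∀ n, M ≤ ‖u n‖ := hanti.le_of_tendsto hM
  rcases isEmpty_or_nonempty X with hX | hX
  · refine (hMle 0).trans ?_
    exact (congrArg norm (Subsingleton.elim (u 0) (u 0 - (f₀ + g₀)))).le
  obtain ⟨K, hK, hdec⟩ := exists_bounded_decomposition hA₁ hA₂ hsum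
  set R := ‖f₀ + g₀‖ + (‖u 0‖ + ‖u 0‖) with hR
  set D := ‖u 0 - (f₀ + g₀)‖ with hD
  have key : ∀ k : ℕ, ∀ ε > 0, M - (2 ^ k - 1) * ε ≤ D + 4 * (K * R) / (k + 1) := by
    intro k ε hε
    obtain ⟨m, hm⟩ := (hM.eventually (gt_mem_nhds (lt_add_of_pos_right M hε))).exists
    obtain ⟨x, s, hs, hx, hval⟩ := exists_bolt hu k m
      (fun n hn => (hanti hn).trans hm.le) hMle
    obtain ⟨f₁, hf₁, g₁, hg₁, h₁⟩ := hmem m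
    obtain ⟨f, hf, g, hg, hfg, hfn, hgn⟩ :=
      hdec (f₀ - f₁) (A₁.sub_mem hf₀ hf₁) (g₀ - g₁) (A₂.sub_mem hg₀ hg₁)
    have hw : f₀ - f₁ + (g₀ - g₁) = (f₀ + g₀) - (u 0 - u m) := by rw [h₁]; abel
    have hwn : ‖f₀ - f₁ + (g₀ - g₁)‖ ≤ R := by
      rw [hw]
      have := norm_sub_le (f₀ + g₀) (u 0 - u m)
      have := norm_sub_le (u 0) (u m)
      have : ‖u m‖ ≤ ‖u 0‖ := hanti (Nat.zero_le m)
      linarith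
    have hum : u m = (u 0 - (f₀ + g₀)) + f + g := by
      rw [add_assoc, ← hfg, hw]; abel
    have hfn' := hfn.trans (mul_le_mul_of_nonneg_left hwn hK.le)
    have hgn' := hgn.trans (mul_le_mul_of_nonneg_left hwn hK.le)
    have hF : |∑ i ∈ Finset.range (k + 1), (-1) ^ i * f (x i)| ≤ 2 * (K * R) := by
      refine abs_alternating_sum_le (q := m + k + 1)
        (fun i => (f.norm_coe_le_norm _).trans hfn') fun i hi he => ?_
      refine hx i (k - 1 - i) (by omega) f ?_
      rwa [if_pos]
      rw [Nat.even_iff] at *; omega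
    have hG : |∑ i ∈ Finset.range (k + 1), (-1) ^ i * g (x i)| ≤ 2 * (K * R) := by
      refine abs_alternating_sum_le (q := m + k)
        (fun i => (g.norm_coe_le_norm _).trans hgn') fun i hi he => ?_
      refine hx i (k - 1 - i) (by omega) g ?_
      rwa [if_neg]
      rw [Nat.even_iff] at *; omega
    have hE : s * ∑ i ∈ Finset.range (k + 1), (-1) ^ i * (u 0 - (f₀ + g₀)) (x i)
        ≤ (k + 1) * D := by
      rw [Finset.mul_sum]
      refine (Finset.sum_le_card_nsmul _ _ D fun i _ => ?_).trans (by simp)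
      have := abs_le.1 ((u 0 - (f₀ + g₀)).norm_coe_le_norm (x i))
      rw [← mul_assoc, mul_comm s]
      rcases neg_one_pow_mul_sign hs i with h | h <;> rw [h] <;> linarith [this.1, this.2]
    have hU : (k + 1) * (M - (2 ^ k - 1) * ε)
        ≤ s * ∑ i ∈ Finset.range (k + 1), (-1) ^ i * u m (x i) := by
      rw [Finset.mul_sum]
      refine le_trans (by simp) (Finset.card_nsmul_le_sum (Finset.range (k + 1)) _
        (M - (2 ^ k - 1) * ε) fun i hi => ?_)
      rw [← mul_assoc, mul_comm s]
      exact hval i (by simpa [Nat.lt_succ_iff] using hi)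
    have hsplit : ∑ i ∈ Finset.range (k + 1), (-1) ^ i * u m (x i)
        = ∑ i ∈ Finset.range (k + 1), (-1) ^ i * (u 0 - (f₀ + g₀)) (x i)
          + ∑ i ∈ Finset.range (k + 1), (-1) ^ i * f (x i)
          + ∑ i ∈ Finset.range (k + 1), (-1) ^ i * g (x i) := by
      rw [← Finset.sum_add_distrib, ← Finset.sum_add_distrib]
      refine Finset.sum_congr rfl fun i _ => ?_
      conv_lhs => rw [hum]
      simp only [ContinuousMap.add_apply]
      ring
    have hk : (0 : ℝ) < k + 1 := by positivity
    rw [← sub_le_iff_le_add', le_div_iff₀ hk]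
    rw [hsplit] at hU
    rw [abs_le] at hF hG
    rcases hs with rfl | rfl <;> linarith [hF.1, hF.2, hG.1, hG.2]
  have hlim : ∀ k : ℕ, M ≤ D + 4 * (K * R) / (k + 1) := by
    intro k
    have ht : Tendsto (fun ε : ℝ => M - (2 ^ k - 1) * ε) (𝓝[>] 0) (𝓝 (M - (2 ^ k - 1) * 0)) :=
      ((continuous_const.sub (continuous_const.mul continuous_id)).tendsto 0).mono_left
        nhdsWithin_le_nhds
    rw [mul_zero, sub_zero] at ht
    exact le_of_tendsto ht (eventually_mem_nhdsWithin.mono fun ε hε => key k ε hε)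
  have ht : Tendsto (fun k : ℕ => D + 4 * (K * R) / ((k : ℝ) + 1)) atTop (𝓝 (D + 0)) := by
    refine tendsto_const_nhds.add ?_
    exact tendsto_const_nhds.div_atTop
      (tendsto_atTop_add_const_right _ _ tendsto_natCast_atTop_atTop)
  rw [add_zero] at ht
  exact ge_of_tendsto' ht hlim

theorem supNorm_coe (v : C(X, ℝ)) : supNorm (v : X → ℝ) = ‖v‖ :=
  (v.norm_eq_iSup_norm).symm

end Sum

/-- Theorem 2.3. Let `X` be compact Hausdorff, `A₁, A₂` closed
subalgebras of `C(X)` containing the constants satisfying the `C`-property, and assume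
`A₁ + A₂` is closed in `C(X)`.  Then for every `h ∈ C(X)` the Diliberto–Straus
iteration `h₁ = h`, `h₂ₙ = h₂ₙ₋₁ − F h₂ₙ₋₁`, `h₂ₙ₊₁ = h₂ₙ − G h₂ₙ` satisfies
`lim ‖hₙ‖ = E(h) = inf_{w ∈ A₁+A₂} ‖h − w‖`. -/
theorem stmt15 {X : Type*} [TopologicalSpace X] [CompactSpace X] [T2Space X]
    (A₁ A₂ : Subalgebra ℝ C(X, ℝ))
    (hA₁ : IsClosed (A₁ : Set C(X, ℝ))) (hA₂ : IsClosed (A₂ : Set C(X, ℝ)))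
    (hC₁ : CProperty A₁) (hC₂ : CProperty A₂)
    (hsum : IsClosed {w : C(X, ℝ) | ∃ f ∈ A₁, ∃ g ∈ A₂, w = f + g})
    (h : C(X, ℝ)) (hseq : ℕ → X → ℝ) (h1 : hseq 1 = ⇑h)
    (heven : ∀ n, 1 ≤ n → ∀ x,
      hseq (2 * n) x = hseq (2 * n - 1) x - Fop A₁ (hseq (2 * n - 1)) x)
    (hodd : ∀ n, 1 ≤ n → ∀ x,
      hseq (2 * n + 1) x = hseq (2 * n) x - Fop A₂ (hseq (2 * n)) x) :
    Tendsto (fun n => supNorm (hseq n)) atTop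
      (𝓝 (sInf {r : ℝ | ∃ f ∈ A₁, ∃ g ∈ A₂, r = ‖h - (f + g)‖})) := by
  have hclosed : ∀ n : ℕ, IsClosed ((if Even n then A₁ else A₂ : Subalgebra ℝ C(X, ℝ)) :
      Set C(X, ℝ)) := fun n => by split_ifs <;> assumption
  have hC : ∀ n : ℕ, CProperty (if Even n then A₁ else A₂) := fun n => by
    split_ifs <;> assumption
  have hrec : ∀ n x, hseq (n + 2) x
      = hseq (n + 1) x - Fop (if Even n then A₁ else A₂) (hseq (n + 1)) x := by
    intro n x
    rcases Nat.even_or_odd' n with ⟨r, rfl | rfl⟩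
    · simpa [mul_add] using heven (r + 1) (by omega) x
    · simpa [mul_add] using hodd (r + 1) (by omega) x
  choose L hL hLop using fun n => exists_isLevelling (hclosed n) (hC n)
  let u : ℕ → C(X, ℝ) := fun n => Nat.rec h (fun n v => L n v) n
  have hu : ∀ n, IsLevelling (if Even n then A₁ else A₂) (u n) (u (n + 1)) :=
    fun n => hL n (u n)
  have hseq_eq : ∀ n, hseq (n + 1) = u n := by
    intro n
    induction n with
    | zero => exact h1
    | succ n ih =>
      funext x
      rw [hrec n x, ih]
      exact (hLop n (u n) x).symm
  have hmem : ∀ n, ∃ f ∈ A₁, ∃ g ∈ A₂, u 0 - u n = f + g := by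
    intro n
    induction n with
    | zero => exact ⟨0, A₁.zero_mem, 0, A₂.zero_mem, by simp⟩
    | succ n ih =>
      obtain ⟨f, hf, g, hg, hfg⟩ := ih
      have hs := (hu n).sub_mem
      have hsplit : u 0 - u (n + 1) = f + g + (u n - u (n + 1)) := by rw [← hfg]; abel
      rw [hsplit]
      split_ifs at hs
      · exact ⟨f + (u n - u (n + 1)), A₁.add_mem hf hs, g, hg, by abel⟩
      · exact ⟨f, hf, g + (u n - u (n + 1)), A₂.add_mem hg hs, by abel⟩
  have hanti : Antitone fun n => ‖u n‖ := antitone_nat_of_succ_le fun n => (hu n).norm_le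
  have hM : Tendsto (fun n => ‖u n‖) atTop (𝓝 (⨅ n, ‖u n‖)) :=
    tendsto_atTop_ciInf hanti ⟨0, by rintro _ ⟨n, rfl⟩; exact norm_nonneg _⟩
  have hE : sInf {r : ℝ | ∃ f ∈ A₁, ∃ g ∈ A₂, r = ‖h - (f + g)‖} = ⨅ n, ‖u n‖ := by
    apply le_antisymm
    · refine le_ciInf fun n => csInf_le ⟨0, ?_⟩ ?_
      · rintro _ ⟨f, -, g, -, rfl⟩
        exact norm_nonneg _
      · obtain ⟨f, hf, g, hg, hfg⟩ := hmem n
        refine ⟨f, hf, g, hg, ?_⟩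
        rw [← hfg]
        exact congrArg norm (sub_sub_cancel h (u n)).symm
    · refine le_csInf ⟨_, 0, A₁.zero_mem, 0, A₂.zero_mem, rfl⟩ ?_
      rintro _ ⟨f, hf, g, hg, rfl⟩
      exact le_norm_sub_of_isLevelling hA₁ hA₂ hsum hu hmem hM hf hg
  rw [hE, ← tendsto_add_atTop_iff_nat 1]
  simpa only [hseq_eq, supNorm_coe] using hM
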